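/- In Version B, any position in which exactly one pile has odd size is an N-position, and any nonempty position in which every pile has odd size is an N-position. -/

import Mathlib

/-- Remove one token from a pile of size `p` in `G`: delete one copy of `p` and,
if `p ≠ 1`, add back a pile of size `p - 1`. -/
def takeOne (G : Multiset ℕ) (p : ℕ) : Multiset ℕ :=
  G.erase p + (if p = 1 then (0 : Multiset ℕ) else {p - 1})

/-- Legal moves of Version B: remove one token from one chosen pile, or remove
one token from every pile simultaneously (piles reaching size 0 are deleted). -/
inductive MoveB : Multiset ℕ → Multiset ℕ → Prop
  | one {G : Multiset ℕ} {p : ℕ} (hp : p ∈ G) (h1 : 1 ≤ p) : MoveB G (takeOne G p)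
  | all {G : Multiset ℕ} (hG : G ≠ 0) : MoveB G ((G.map (· - 1)).filter (· ≠ 0))

mutual
  /-- P-positions of Version B under normal play: every move leads to an N-position
  (in particular the empty position is a P-position).  Since every move strictly
  decreases the total number of tokens, this inductive definition agrees with the
  usual recursive definition of outcome classes. -/
  inductive PPosB : Multiset ℕ → Prop
    | mk : ∀ {G : Multiset ℕ}, (∀ H, MoveB G H → NPosB H) → PPosB G
  /-- N-positions of Version B under normal play: some move leads to a P-position. -/
  inductive NPosB : Multiset ℕ → Prop
    | mk : ∀ {G H : Multiset ℕ}, MoveB G H → PPosB H → NPosB G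
end

theorem zero_notMem_takeOne {G : Multiset ℕ} (hG : 0 ∉ G) (p : ℕ) (hp : p ∈ G) :
    0 ∉ takeOne G p := by
  have hp0 : p ≠ 0 := fun h => hG (h ▸ hp)
  intro h
  rw [takeOne, Multiset.mem_add] at h
  rcases h with h | h
  · exact hG (Multiset.mem_of_mem_erase h)
  · split_ifs at h with h1
    · simp at h
    · rw [Multiset.mem_singleton] at h
      omega

theorem sum_takeOne {G : Multiset ℕ} {p : ℕ} (hp : p ∈ G) (h1 : 1 ≤ p) :
    (takeOne G p).sum + 1 = G.sum := by
  obtain ⟨K, rfl⟩ := Multiset.exists_cons_of_mem hp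
  by_cases h : p = 1
  · simp [takeOne, h, add_comm]
  · simp only [takeOne, Multiset.erase_cons_head, h, if_false, Multiset.sum_add,
      Multiset.sum_singleton, Multiset.sum_cons]
    omega

theorem sum_filter_map_pred_le (G : Multiset ℕ) :
    ((G.map (· - 1)).filter (· ≠ 0)).sum ≤ G.sum := by
  induction G using Multiset.induction_on with
  | empty => simp
  | cons a K ih =>
    rw [Multiset.map_cons, Multiset.filter_cons, Multiset.sum_add, Multiset.sum_cons]
    split_ifs <;> simp at ih ⊢ <;> omega

theorem MoveB.zero_notMem {G H : Multiset ℕ} (hG : 0 ∉ G) (h : MoveB G H) : 0 ∉ H := by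
  cases h with
  | one hp _ => exact zero_notMem_takeOne hG _ hp
  | all _ => simp

theorem MoveB.sum_lt {G H : Multiset ℕ} (hG : 0 ∉ G) (h : MoveB G H) : H.sum < G.sum := by
  cases h with
  | one hp h1 =>
    have := sum_takeOne hp h1
    omega
  | all h0 =>
    obtain ⟨a, ha⟩ := Multiset.exists_mem_of_ne_zero h0
    obtain ⟨K, rfl⟩ := Multiset.exists_cons_of_mem ha
    have ha0 : a ≠ 0 := by rintro rfl; exact hG ha
    have := sum_filter_map_pred_le K
    rw [Multiset.map_cons, Multiset.filter_cons, Multiset.sum_add, Multiset.sum_cons]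
    split_ifs <;> simp at this ⊢ <;> omega

/-- Removing a token from the only odd pile makes every pile even. -/
theorem exists_moveB_even_of_card_odd_eq_one {G : Multiset ℕ}
    (h : (G.filter (fun p => Odd p)).card = 1) :
    ∃ H, MoveB G H ∧ ∀ q ∈ H, Even q := by
  obtain ⟨p, hp⟩ := Multiset.card_eq_one.1 h
  have hpm : p ∈ G.filter (fun p => Odd p) := hp ▸ Multiset.mem_singleton_self p
  obtain ⟨hpG, hodd⟩ := Multiset.mem_filter.1 hpm
  refine ⟨takeOne G p, .one hpG hodd.pos, fun q hq => ?_⟩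
  rw [takeOne, Multiset.mem_add] at hq
  rcases hq with hq | hq
  · obtain ⟨K, rfl⟩ := Multiset.exists_cons_of_mem hpG
    rw [Multiset.filter_cons_of_pos _ hodd] at hp
    have hK : K.filter (fun p => Odd p) = 0 := by simpa using congrArg Multiset.card hp
    rw [Multiset.erase_cons_head] at hq
    exact Nat.not_odd_iff_even.1 (Multiset.filter_eq_nil.1 hK q hq)
  · split_ifs at hq with h1
    · simp at hq
    · rw [Multiset.mem_singleton.1 hq]
      exact hodd.tsub_odd odd_one

/-- Removing a token from every pile makes every pile even, if all of them are odd. -/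
theorem exists_moveB_even_of_forall_odd {G : Multiset ℕ} (h0 : G ≠ 0) (h : ∀ p ∈ G, Odd p) :
    ∃ H, MoveB G H ∧ ∀ q ∈ H, Even q := by
  refine ⟨_, .all h0, fun q hq => ?_⟩
  obtain ⟨p, hp, rfl⟩ := Multiset.mem_map.1 (Multiset.mem_filter.1 hq).1
  exact (h p hp).tsub_odd odd_one

theorem MoveB.card_odd_eq_one_or_forall_odd {G H : Multiset ℕ} (hG : 0 ∉ G)
    (h : ∀ p ∈ G, Even p) (hm : MoveB G H) :
    (H.filter (fun p => Odd p)).card = 1 ∨ H ≠ 0 ∧ ∀ p ∈ H, Odd p := by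
  have hodd : ∀ p ∈ G, Odd (p - 1) := fun p hp =>
    Nat.Even.sub_odd (Nat.one_le_iff_ne_zero.2 fun h0 => hG (h0 ▸ hp)) (h p hp) odd_one
  cases hm with
  | @one p hp _ =>
    left
    have h1 : p ≠ 1 := by rintro rfl; exact absurd (h 1 hp) (by decide)
    have hK : (G.erase p).filter (fun p => Odd p) = 0 :=
      Multiset.filter_eq_nil.2 fun q hq =>
        Nat.not_odd_iff_even.2 (h q (Multiset.mem_of_mem_erase hq))
    rw [takeOne, if_neg h1, Multiset.filter_add, hK, zero_add,
      Multiset.filter_singleton, if_pos (hodd p hp), Multiset.card_singleton]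
  | all h0 =>
    right
    constructor
    · obtain ⟨a, ha⟩ := Multiset.exists_mem_of_ne_zero h0
      intro he
      have : a - 1 ∈ (G.map (· - 1)).filter (· ≠ 0) :=
        Multiset.mem_filter.2 ⟨Multiset.mem_map_of_mem _ ha, (hodd a ha).pos.ne'⟩
      rw [he] at this
      simp at this
    · intro q hq
      obtain ⟨p, hp, rfl⟩ := Multiset.mem_map.1 (Multiset.mem_filter.1 hq).1
      exact hodd p hp

theorem PPosB.of_forall_even (G : Multiset ℕ) (hG : 0 ∉ G) (h : ∀ p ∈ G, Even p) :
    PPosB G := by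
  refine .mk fun H hGH => ?_
  obtain ⟨K, hHK, hK⟩ : ∃ K, MoveB H K ∧ ∀ q ∈ K, Even q :=
    (hGH.card_odd_eq_one_or_forall_odd hG h).elim exists_moveB_even_of_card_odd_eq_one
      fun h => exists_moveB_even_of_forall_odd h.1 h.2
  have hH := hGH.zero_notMem hG
  exact .mk hHK (PPosB.of_forall_even K (hHK.zero_notMem hH) hK)
termination_by G.sum
decreasing_by exact (hHK.sum_lt hH).trans (hGH.sum_lt hG)

/-- In Version B, any position with exactly one odd pile is an N-position, and any
nonempty position in which every pile is odd is an N-position. -/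
theorem versionB_odd_NPos (G : Multiset ℕ) (hG : 0 ∉ G) :
    ((G.filter (fun p => Odd p)).card = 1 → NPosB G) ∧
    (G ≠ 0 → (∀ p ∈ G, Odd p) → NPosB G) := by
  constructor
  · intro h
    obtain ⟨H, hm, hH⟩ := exists_moveB_even_of_card_odd_eq_one h
    exact .mk hm (.of_forall_even H (hm.zero_notMem hG) hH)
  · intro h0 h
    obtain ⟨H, hm, hH⟩ := exists_moveB_even_of_forall_odd h0 h
    exact .mk hm (.of_forall_even H (hm.zero_notMem hG) hH)
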